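/- The Fourier-type integral identity ∫_ℝ (2/π) ln|coth(πt/2)| e^{−iνt} dt = tanh(ν/2)/(ν/2) holds for all real ν ≠ 0, and equals 1 at ν = 0. -/

import Mathlib

open MeasureTheory


lemma hp_coth (y : ℝ) (hy : y ≠ 0) :
    HasSum (fun n : ℕ => (1:ℝ) / (((n:ℝ) + 1)^2 * Real.pi^2 + y^2))
      ((Real.cosh y / Real.sinh y - 1 / y) / (2 * y)) := by
  have hpi : (Real.pi : ℂ) ≠ 0 := Complex.ofReal_ne_zero.2 Real.pi_ne_zero
  have hyc : (y : ℂ) ≠ 0 := Complex.ofReal_ne_zero.2 hy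
  set x : ℂ := (y / Real.pi : ℝ) * Complex.I with hx
  have hxm : x ∈ Complex.integerComplement := by
    rintro ⟨n, hn⟩
    have := congrArg Complex.im hn
    simp [hx] at this
    exact div_ne_zero hy Real.pi_ne_zero this.symm
  have h1 : HasSum (fun n => cotTerm x n) (Real.pi * Complex.cot (Real.pi * x) - 1 / x) := by
    rw [cot_series_rep' hxm]
    exact (summable_cotTerm hxm).hasSum
  have h2 := h1.mul_left (Complex.I / (2 * y * Real.pi))
  rw [← Complex.hasSum_ofReal]
  convert! h2 using 1
  · funext n
    rw [cotTerm_identity hxm]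
    have e : (x + (n + 1)) * (x - (n + 1)) = - (((n:ℂ) + 1)^2 * Real.pi^2 + y^2) / Real.pi^2 := by
      rw [hx]; push_cast
      field_simp
      ring_nf
      simp
    rw [e, hx]
    have h0 : (((n:ℂ) + 1)^2 * Real.pi^2 + y^2) ≠ 0 := by
      have : (((n:ℝ) + 1)^2 * Real.pi^2 + y^2) ≠ 0 := by positivity
      exact_mod_cast this
    push_cast
    field_simp
    simp
  · have e : Real.pi * x = y * Complex.I := by rw [hx]; push_cast; field_simp
    have hs : Complex.sinh y ≠ 0 := by
      rw [← Complex.ofReal_sinh]; exact_mod_cast Real.sinh_ne_zero.2 hy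
    rw [e, Complex.cot, Complex.cos_mul_I, Complex.sin_mul_I, hx]
    push_cast
    field_simp

lemma hp_odd (f g : ℕ → ℝ) (S T : ℝ) (hf : HasSum f S) (hg : HasSum g T)
    (h : ∀ k, f (2 * k + 1) = g k / 4) : HasSum (fun k => f (2 * k)) (S - T / 4) := by
  have he : Summable (fun k => f (2 * k)) :=
    hf.summable.comp_injective (i := fun k : ℕ => 2 * k) (fun a b h => by simpa using h)
  have ho : HasSum (fun k => f (2 * k + 1)) (T / 4) := by
    simpa only [h] using hg.div_const 4
  have := (he.hasSum.even_add_odd ho).unique hf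
  rw [← this]; simpa using he.hasSum

lemma hp_tanh (ν : ℝ) :
    HasSum (fun k : ℕ => (8:ℝ) / ((2 * (k:ℝ) + 1)^2 * Real.pi^2 + ν^2))
      (if ν = 0 then 1 else Real.tanh (ν / 2) / (ν / 2)) := by
  have hpi := Real.pi_pos
  split_ifs with h
  · subst h
    have hz : HasSum (fun n : ℕ => (1:ℝ) / ((n:ℝ) + 1)^2) (Real.pi^2 / 6) := by
      have := (hasSum_nat_add_iff' 1).2 hasSum_zeta_two
      simpa using this
    have := (hp_odd _ _ _ _ hz hz (fun k => by push_cast; field_simp; ring)).mul_left (8 / Real.pi^2)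
    convert! this using 1
    · funext k; push_cast; field_simp; simp
    · field_simp; norm_num
  · have := (hp_odd _ _ _ _ (hp_coth ν h) (hp_coth (ν / 2) (by simpa using h))
      (fun k => by push_cast; field_simp; ring)).mul_left 8
    convert! this using 1
    · funext k; push_cast; field_simp
    · obtain ⟨w, rfl⟩ : ∃ w, ν = 2 * w := ⟨ν / 2, by ring⟩
      have hw : w ≠ 0 := by simpa using h
      have hs := Real.sinh_ne_zero.2 hw
      have hc := (Real.cosh_pos w).ne'
      rw [show 2 * w / 2 = w by ring, Real.tanh_eq_sinh_div_cosh, Real.sinh_two_mul,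
        Real.cosh_two_mul]
      field_simp
      ring

lemma hp_int (a ν : ℝ) (ha : 0 < a) :
    Integrable (fun t : ℝ => (Real.exp (-a * |t|) : ℂ) * Complex.exp (-Complex.I * ν * t)) ∧
    ∫ t : ℝ, (Real.exp (-a * |t|) : ℂ) * Complex.exp (-Complex.I * ν * t)
      = ((2 * a / (a^2 + ν^2) : ℝ) : ℂ) := by
  have r1 : (-(a:ℂ) - Complex.I * ν).re < 0 := by simpa using ha
  have r2 : 0 < ((a:ℂ) - Complex.I * ν).re := by simpa using ha
  have e1 : Set.EqOn (fun t : ℝ => Complex.exp ((-(a:ℂ) - Complex.I * ν) * t))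
      (fun t : ℝ => (Real.exp (-a * |t|) : ℂ) * Complex.exp (-Complex.I * ν * t)) (Set.Ioi 0) := by
    intro t ht
    simp only [abs_of_pos (Set.mem_Ioi.1 ht)]
    push_cast
    rw [← Complex.exp_add]; ring_nf
  have e2 : Set.EqOn (fun t : ℝ => Complex.exp (((a:ℂ) - Complex.I * ν) * t))
      (fun t : ℝ => (Real.exp (-a * |t|) : ℂ) * Complex.exp (-Complex.I * ν * t)) (Set.Iic 0) := by
    intro t ht
    simp only [abs_of_nonpos (Set.mem_Iic.1 ht)]
    push_cast
    rw [← Complex.exp_add]; ring_nf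
  have i1 := (integrableOn_exp_mul_complex_Ioi r1 0).congr_fun e1 measurableSet_Ioi
  have i2 := (integrableOn_exp_mul_complex_Iic r2 0).congr_fun e2 measurableSet_Iic
  refine ⟨?_, ?_⟩
  · rw [← integrableOn_univ, ← Set.Iic_union_Ioi (a := (0:ℝ))]
    exact i2.union i1
  · rw [← intervalIntegral.integral_Iic_add_Ioi i2 i1, ← setIntegral_congr_fun measurableSet_Ioi e1,
      ← setIntegral_congr_fun measurableSet_Iic e2, integral_exp_mul_complex_Ioi r1,
      integral_exp_mul_complex_Iic r2]
    have n1 : (-(a:ℂ) - Complex.I * ν) ≠ 0 := fun h => by rw [h] at r1; simp at r1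
    have n2 : ((a:ℂ) - Complex.I * ν) ≠ 0 := fun h => by rw [h] at r2; simp at r2
    have n3 : ((a:ℂ)^2 + ν^2) ≠ 0 := by
      have : (a^2 + ν^2) ≠ 0 := by positivity
      exact_mod_cast this
    push_cast
    simp only [mul_zero, Complex.exp_zero]
    rw [div_add_div _ _ n2 n1, div_eq_div_iff (mul_ne_zero n2 n1) n3]
    have : Complex.I ^ 2 = -1 := Complex.I_sq
    linear_combination (-2 * a * ν^2 : ℂ) * this

lemma hp_log (t : ℝ) (ht : t ≠ 0) :
    HasSum (fun k : ℕ => (2 : ℝ) * (1 / (2 * k + 1)) * Real.exp (-((2 * k + 1) * Real.pi) * |t|))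
      (Real.log |Real.cosh (Real.pi * t / 2) / Real.sinh (Real.pi * t / 2)|) := by
  have hp : 0 < Real.pi * |t| := mul_pos Real.pi_pos (abs_pos.2 ht)
  set x := Real.exp (-(Real.pi * |t|)) with hx
  have hx0 : 0 < x := Real.exp_pos _
  have hx1 : x < 1 := by rw [hx, Real.exp_lt_one_iff]; linarith
  have h := Real.hasSum_log_sub_log_of_abs_lt_one (x := x) (by rw [abs_of_pos hx0]; exact hx1)
  convert! h using 1
  · funext k
    rw [hx, ← Real.exp_nat_mul]; push_cast; ring_nf
  · rw [← Real.log_div (by linarith) (by linarith)]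
    congr 1
    rw [abs_div, Real.abs_sinh, abs_of_pos (Real.cosh_pos _), ← Real.cosh_abs]
    have : |Real.pi * t / 2| = Real.pi * |t| / 2 := by
      rw [abs_div, abs_mul, abs_of_pos Real.pi_pos]; norm_num
    rw [this, Real.cosh_eq, Real.sinh_eq]
    set u := Real.exp (Real.pi * |t| / 2) with hu
    have hu0 : 0 < u := Real.exp_pos _
    have hu1 : 1 < u := by rw [hu, Real.one_lt_exp_iff]; linarith
    have hxu : x = 1 / u^2 := by
      rw [hx, hu, ← Real.exp_nat_mul, one_div, ← Real.exp_neg]; congr 1; push_cast; ring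
    rw [Real.exp_neg, ← hu, hxu]
    have : u^2 - 1 ≠ 0 := by nlinarith
    have h3 : u - u⁻¹ ≠ 0 := by
      intro h
      apply this
      field_simp at h
      linarith
    have h4 : 1 - 1 / u^2 ≠ 0 := by
      rw [← hxu]; linarith
    rw [div_eq_div_iff (by simpa using h3) h4]
    field_simp

lemma hp_main (ν : ℝ) :
    (∫ t : ℝ, ((2 / Real.pi) *
            Real.log |Real.cosh (Real.pi * t / 2) / Real.sinh (Real.pi * t / 2)| : ℂ) *
          Complex.exp (-Complex.I * (ν : ℂ) * (t : ℂ)))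
        = ((if ν = 0 then 1 else Real.tanh (ν / 2) / (ν / 2) : ℝ) : ℂ) := by
  have hpi := Real.pi_pos
  let c : ℕ → ℝ := fun k => 2 / Real.pi * (2 * (1 / (2 * k + 1)))
  let a : ℕ → ℝ := fun k => (2 * k + 1) * Real.pi
  have hc : ∀ k, 0 < c k := fun k => by positivity
  have ha : ∀ k, 0 < a k := fun k => by positivity
  let F : ℕ → ℝ → ℂ := fun k t =>
    (c k : ℂ) * ((Real.exp (-a k * |t|) : ℂ) * Complex.exp (-Complex.I * ν * t))
  have hca : ∀ k (μ : ℝ), c k * (2 * a k / ((a k)^2 + μ^2)) =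
      (8:ℝ) / ((2 * (k:ℝ) + 1)^2 * Real.pi^2 + μ^2) := by
    intro k μ
    simp only [c, a]
    rw [mul_pow]
    field_simp
    ring
  have hI : ∀ k, Integrable (F k) := fun k => (hp_int (a k) ν (ha k)).1.const_mul _
  have hN : ∀ k, ∫ t, ‖F k t‖ = (8:ℝ) / ((2 * (k:ℝ) + 1)^2 * Real.pi^2 + 0^2) := by
    intro k
    rw [← hca k 0, ← Complex.ofReal_inj, Complex.ofReal_mul, ← (hp_int (a k) 0 (ha k)).2,
      ← integral_complex_ofReal, ← integral_const_mul]
    congr 1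
    funext t
    have : ‖Complex.exp (-Complex.I * ν * t)‖ = 1 := by
      rw [Complex.norm_exp]; simp
    simp only [F]
    rw [norm_mul, norm_mul, this, Complex.norm_real, Complex.norm_real,
      Real.norm_of_nonneg (hc k).le, Real.norm_of_nonneg (Real.exp_pos _).le]
    simp
  have hS := hasSum_integral_of_summable_integral_norm hI
    (by simp only [hN]; exact (hp_tanh 0).summable)
  have hV : ∀ k, ∫ t, F k t = (((8:ℝ) / ((2 * (k:ℝ) + 1)^2 * Real.pi^2 + ν^2) : ℝ) : ℂ) := by
    intro k
    simp only [F]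
    rw [integral_const_mul, (hp_int (a k) ν (ha k)).2, ← Complex.ofReal_mul, hca]
  simp only [hV] at hS
  rw [← hS.unique (Complex.hasSum_ofReal.2 (hp_tanh ν))]
  apply integral_congr_ae
  have hne : ∀ᵐ t : ℝ, t ≠ 0 := by simp [ae_iff]
  filter_upwards [hne] with t ht
  have := (Complex.hasSum_ofReal.2 ((hp_log t ht).mul_left (2 / Real.pi))).mul_right
    (Complex.exp (-Complex.I * ν * t))
  symm
  convert! this.tsum_eq using 1
  · congr 1
    funext k
    simp only [F, c, a]
    push_cast
    ring_nf
  · push_cast; rfl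

/-- Fourier transform of the "high-peak tent" density
p(t) = (2/π) ln|coth(πt/2)| (with coth x = cosh x / sinh x):
∫_ℝ p(t) e^{−iνt} dt = tanh(ν/2)/(ν/2) for ν ≠ 0, and equals 1 at ν = 0. -/
theorem highPeakTent_fourierTransform (ν : ℝ) :
    (ν ≠ 0 →
      (∫ t : ℝ, ((2 / Real.pi) *
            Real.log |Real.cosh (Real.pi * t / 2) / Real.sinh (Real.pi * t / 2)| : ℂ) *
          Complex.exp (-Complex.I * (ν : ℂ) * (t : ℂ)))
        = ((Real.tanh (ν / 2) / (ν / 2) : ℝ) : ℂ)) ∧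
    (ν = 0 →
      (∫ t : ℝ, ((2 / Real.pi) *
            Real.log |Real.cosh (Real.pi * t / 2) / Real.sinh (Real.pi * t / 2)| : ℂ) *
          Complex.exp (-Complex.I * (ν : ℂ) * (t : ℂ)))
        = 1) := by

  refine ⟨fun h => ?_, fun h => ?_⟩
  · rw [hp_main, if_neg h]
  · rw [hp_main, if_pos h]; simp
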